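/- Let x : X → S and y : Y → S be S-schemes, let i : Z ↪ P be a compactification of x with complementary open immersion j_i : X ↪ P, let l : W ↪ Q be a compactification of y with complementary open immersion j_l : Y ↪ Q, and let (f₀, g₀), (f₁, g₁) : i → l be two morphisms of compactifications. Then there exist an S-scheme x', a compactification i' : Z' ↪ P' of x', and a morphism of compactifications (f, g) : i' → i such that (f₀, g₀) ∘ (f, g) = (f₁, g₁) ∘ (f, g). Moreover, if the base changes of g₀ and g₁ along j_l coincide as morphisms X → Y, then x' can be chosen to be x and (f, g) can be chosen so that the identity morphism of X is the base change of g along j_i. -/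

import Mathlib

open CategoryTheory AlgebraicGeometry CategoryTheory.Limits

/-- A compactification of an `S`-scheme `X` (an object of `Over S`): a closed immersion
`i : Z ↪ P` of proper `S`-schemes together with a complementary open immersion `j : X ↪ P`,
i.e. the set-theoretic image of `j` is the complement of the set-theoretic image of `i`. -/
structure Compactification {S : Scheme.{0}} (X : Over S) where
  /-- the boundary -/
  Z : Over S
  /-- the ambient proper `S`-scheme -/
  P : Over S
  properZ : IsProper Z.hom
  properP : IsProper P.hom
  /-- the closed immersion `Z ↪ P` -/
  i : Z ⟶ P
  closed_i : IsClosedImmersion i.left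
  /-- the complementary open immersion `X ↪ P` -/
  j : X ⟶ P
  open_j : IsOpenImmersion j.left
  compl : Set.range j.left.base = (Set.range i.left.base)ᶜ

/-- A morphism of compactifications `(f, g) : i → l`: morphisms `f : Z ⟶ W` and `g : P ⟶ Q`
of `S`-schemes such that `g ∘ i = l ∘ f` and the induced morphism `Z → W ×_Q P` to the fibre
product is surjective. -/
structure CompMor {S : Scheme.{0}} {X Y : Over S} (C : Compactification X)
    (D : Compactification Y) where
  /-- the morphism on boundaries -/
  f : C.Z ⟶ D.Z
  /-- the morphism on ambient schemes -/
  g : C.P ⟶ D.P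
  comm : C.i.left ≫ g.left = f.left ≫ D.i.left
  surj : Function.Surjective (pullback.lift f.left C.i.left comm.symm).base

/-- `h : X ⟶ Y` is the base change of `g : C.P ⟶ D.P` along `j_l = D.j`: the square with top
arrow `C.j : X ↪ C.P`, bottom arrow `D.j : Y ↪ D.P`, left arrow `h` and right arrow `g`
commutes and is Cartesian. -/
def IsBaseChangeOf {S : Scheme.{0}} {X Y : Over S} (C : Compactification X)
    (D : Compactification Y) (g : C.P ⟶ D.P) (h : X ⟶ Y) : Prop :=
  IsPullback C.j.left h.left g.left D.j.left

/-- The range of a base change of schemes is the preimage of the range. -/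
lemma range_eq_preimage_of_isPullback {A B T U : Scheme.{0}} {a : A ⟶ B} {b : A ⟶ T}
    {c : B ⟶ U} {d : T ⟶ U} (h : IsPullback a b c d) :
    Set.range a = c ⁻¹' Set.range d := by
  rw [← Scheme.Pullback.range_fst, ← h.isoPullback_hom_fst, Scheme.Hom.comp_base,
    TopCat.coe_comp, Set.range_comp, h.isoPullback.hom.surjective.range_eq, Set.image_univ]

/-- The base change of a compactification along a proper morphism `g : P' ⟶ C.P`. -/
noncomputable def Compactification.baseChange {S : Scheme.{0}} {X X' P' : Over S}
    (C : Compactification X) (g : P' ⟶ C.P) [IsProper g.left] (j : X' ⟶ P') (h : X' ⟶ X)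
    (hj : IsPullback j.left h.left g.left C.j.left) : Compactification X' where
  Z := Over.mk (pullback.snd C.i.left g.left ≫ P'.hom)
  P := P'
  properZ := by
    have := C.closed_i
    have := C.properP
    change IsProper (pullback.snd C.i.left g.left ≫ P'.hom)
    rw [← Over.w g]
    infer_instance
  properP := by
    have := C.properP
    rw [← Over.w g]
    infer_instance
  i := Over.homMk (pullback.snd C.i.left g.left)
  closed_i := by
    have := C.closed_i
    exact inferInstanceAs (IsClosedImmersion (pullback.snd C.i.left g.left))
  j := j
  open_j := by
    have := C.open_j
    exact MorphismProperty.of_isPullback hj.flip this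
  compl := by
    change _ = (Set.range (pullback.snd C.i.left g.left))ᶜ
    rw [Scheme.Pullback.range_snd, range_eq_preimage_of_isPullback hj, C.compl,
      Set.preimage_compl]

/-- The projection from the base change of a compactification. -/
noncomputable def Compactification.baseChangeHom {S : Scheme.{0}} {X X' P' : Over S}
    (C : Compactification X) (g : P' ⟶ C.P) [IsProper g.left] (j : X' ⟶ P') (h : X' ⟶ X)
    (hj : IsPullback j.left h.left g.left C.j.left) : CompMor (C.baseChange g j h hj) C where
  f := Over.homMk (pullback.fst C.i.left g.left) (by
    change pullback.fst C.i.left g.left ≫ C.Z.hom = pullback.snd C.i.left g.left ≫ P'.hom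
    rw [← Over.w C.i, pullback.condition_assoc, Over.w g])
  g := g
  comm := pullback.condition.symm
  surj := by
    have : pullback.lift (pullback.fst C.i.left g.left) (pullback.snd C.i.left g.left)
        pullback.condition = 𝟙 _ := by
      ext1 <;> simp
    refine fun x => ⟨x, ?_⟩
    exact congr($this x)

/-- Morphisms of compactifications agree as soon as they agree on the ambient schemes. -/
lemma CompMor.comp_f_eq {S : Scheme.{0}} {X X' Y : Over S} {C' : Compactification X'}
    {C : Compactification X} {D : Compactification Y} (m : CompMor C' C) (m₀ m₁ : CompMor C D)
    (h : m.g ≫ m₀.g = m.g ≫ m₁.g) : m.f ≫ m₀.f = m.f ≫ m₁.f := by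
  have := D.closed_i
  ext1
  rw [← cancel_mono D.i.left, Over.comp_left, Over.comp_left, Category.assoc, Category.assoc,
    ← m₀.comm, ← m₁.comm, ← reassoc_of% m.comm, ← reassoc_of% m.comm, ← Over.comp_left, h,
    Over.comp_left]

/-!
STATEMENT 2: Let `x : X → S` and `y : Y → S` be `S`-schemes, `i : Z ↪ P` a
compactification of `x`, `l : W ↪ Q` a compactification of `y`, and let
`(f₀, g₀), (f₁, g₁) : i → l` be two morphisms of compactifications.  Then there exist an
`S`-scheme `x'`, a compactification `i' : Z' ↪ P'` of `x'` and a morphism of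
compactifications `(f, g) : i' → i` with `(f₀, g₀) ∘ (f, g) = (f₁, g₁) ∘ (f, g)`
(composition of morphisms of compactifications being componentwise).  Moreover, if the base
changes of `g₀` and `g₁` along `j_l` coincide as morphisms `X → Y`, then `x'` can be
chosen to be `x` and `(f, g)` so that `𝟙 X` is the base change of `g` along `j_i`.
-/
theorem statement2
    (S : Scheme.{0}) [IsNoetherian S] [S.IsSeparated]
    (X Y : Over S)
    [IsNoetherian X.left] [IsNoetherian Y.left] [X.left.IsSeparated] [Y.left.IsSeparated]
    [LocallyOfFiniteType X.hom] [QuasiCompact X.hom]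
    [LocallyOfFiniteType Y.hom] [QuasiCompact Y.hom]
    (C : Compactification X) (D : Compactification Y)
    (m₀ m₁ : CompMor C D) :
    (∃ (X' : Over S) (_ : LocallyOfFiniteType X'.hom) (_ : QuasiCompact X'.hom)
        (C' : Compactification X') (m : CompMor C' C),
        m.f ≫ m₀.f = m.f ≫ m₁.f ∧ m.g ≫ m₀.g = m.g ≫ m₁.g) ∧
    ((∃ h : X ⟶ Y, IsBaseChangeOf C D m₀.g h ∧ IsBaseChangeOf C D m₁.g h) →
      ∃ (C' : Compactification X) (m : CompMor C' C),
        (m.f ≫ m₀.f = m.f ≫ m₁.f ∧ m.g ≫ m₀.g = m.g ≫ m₁.g) ∧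
        IsBaseChangeOf C' C m.g (𝟙 X)) := by
  have := D.properP
  let e := equalizer.ι m₀.g m₁.g
  have he : e ≫ m₀.g = e ≫ m₁.g := equalizer.condition _ _
  have : IsClosedImmersion e.left := isClosedImmersion_equalizer_ι_left _ _
  refine ⟨?_, ?_⟩
  · let h : Over.mk (pullback.snd e.left C.j.left ≫ X.hom) ⟶ X :=
      Over.homMk (pullback.snd e.left C.j.left)
    let j : Over.mk (pullback.snd e.left C.j.left ≫ X.hom) ⟶ equalizer m₀.g m₁.g :=
      Over.homMk (pullback.fst e.left C.j.left) (by
        rw [← Over.w e, pullback.condition_assoc, Over.w C.j]; rfl)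
    have hj : IsPullback j.left h.left e.left C.j.left := IsPullback.of_hasPullback _ _
    let m := C.baseChangeHom e j h hj
    exact ⟨_, inferInstanceAs (LocallyOfFiniteType (_ ≫ X.hom)),
      inferInstanceAs (QuasiCompact (_ ≫ X.hom)), _, m, m.comp_f_eq m₀ m₁ he, he⟩
  · rintro ⟨h, h₀, h₁⟩
    have hC : C.j ≫ m₀.g = C.j ≫ m₁.g := by
      ext1
      exact h₀.w.trans h₁.w.symm
    let j := equalizer.lift C.j hC
    have hj : IsPullback j.left (𝟙 X : X ⟶ X).left e.left C.j.left := by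
      have w : j.left ≫ e.left = C.j.left := by
        rw [← Over.comp_left, equalizer.lift_ι]
      refine ⟨⟨by simp [w]⟩, ⟨PullbackCone.IsLimit.mk _ (fun s => s.snd) (fun s => ?_)
        (fun s => ?_) (fun s t _ ht => ?_)⟩⟩
      · rw [← cancel_mono e.left, Category.assoc, w, s.condition]
      · simp
      · simpa using ht
    let m := C.baseChangeHom e j (𝟙 X) hj
    exact ⟨_, m, ⟨m.comp_f_eq m₀ m₁ he, he⟩, hj⟩
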